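/- arXiv:2208.08397 — 4 statements merged into one kernel-verified Lean document; each statement's English description precedes it below -/
import Mathlib

section
/- Let d ∈ ℕ be even, let W assign a nonnegative real weight W_{i,j} to each unordered pair {i,j} of distinct elements of Fin d, and let P ∈ ℝ with P > Σ_{i<j} W_{i,j}. Define Q(x) = Σ_{i<j} W_{i,j} x_{i,j} + P · Σ_{i=1}^{d} (1 − Σ_{j ≠ i} x_{i,j})² for binary assignments x with x_{i,j} ∈ {0,1} and x_{i,j} = x_{j,i}. Then every binary assignment x minimizing Q satisfies the constraint Σ_{i=1}^{d} (1 − Σ_{j ≠ i} x_{i,j})² = 0. -/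
/-- A binary assignment on unordered pairs of distinct elements of `Fin d`:
each pair `{i,j}` with `i ≠ j` receives a value in `{0,1} ⊆ ℝ`. -/
def IsBinaryAssignment (d : ℕ) (x : Sym2 (Fin d) → ℝ) : Prop :=
  ∀ i j : Fin d, i ≠ j → x s(i, j) = 0 ∨ x s(i, j) = 1

/-- The perfect-pairing constraint term `C(x) = ∑ i, (1 − ∑ j ≠ i, x {i,j})²`. -/
noncomputable def pairingConstraint (d : ℕ) (x : Sym2 (Fin d) → ℝ) : ℝ :=
  ∑ i : Fin d, (1 - ∑ j ∈ Finset.univ.filter (· ≠ i), x s(i, j)) ^ 2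

/-- The QUBO objective
`Q(x) = ∑_{i<j} W {i,j} * x {i,j} + P * ∑ i, (1 − ∑ j ≠ i, x {i,j})²`. -/
noncomputable def quboObjective (d : ℕ) (W : Sym2 (Fin d) → ℝ) (P : ℝ)
    (x : Sym2 (Fin d) → ℝ) : ℝ :=
  (∑ i : Fin d, ∑ j ∈ Finset.Ioi i, W s(i, j) * x s(i, j)) +
    P * pairingConstraint d x

/-- For even `d`, there is a fixed-point-free involution of `Fin d`. -/
theorem exists_fixedPointFree_involutive_fin {d : ℕ} (hd : Even d) :
    ∃ σ : Fin d → Fin d, Function.Involutive σ ∧ ∀ i, σ i ≠ i := by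
  obtain ⟨k, rfl⟩ := hd
  refine ⟨fun i => ⟨if i.1 % 2 = 0 then i.1 + 1 else i.1 - 1, ?_⟩, fun i => ?_, fun i => ?_⟩
  · have := i.2
    split_ifs <;> omega
  · apply Fin.ext
    dsimp only
    split_ifs <;> omega
  · rw [Ne, Fin.ext_iff]
    dsimp only
    split_ifs <;> omega

/-- For even `d`, some binary assignment satisfies the pairing constraint. -/
theorem exists_isBinaryAssignment_pairingConstraint_eq_zero {d : ℕ} (hd : Even d) :
    ∃ y : Sym2 (Fin d) → ℝ, IsBinaryAssignment d y ∧ pairingConstraint d y = 0 := by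
  classical
  obtain ⟨σ, hσ, hne⟩ := exists_fixedPointFree_involutive_fin hd
  let y : Sym2 (Fin d) → ℝ := fun e => if ∃ i, e = s(i, σ i) then 1 else 0
  have hy : ∀ i j, y s(i, j) = if j = σ i then 1 else 0 := by
    intro i j
    refine if_congr ⟨?_, ?_⟩ rfl rfl
    · rintro ⟨a, ha⟩
      rcases Sym2.eq_iff.mp ha with ⟨rfl, rfl⟩ | ⟨rfl, rfl⟩
      · rfl
      · exact (hσ _).symm
    · rintro rfl
      exact ⟨i, rfl⟩
  refine ⟨y, fun i j _ => ?_, ?_⟩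
  · rw [hy]
    split_ifs <;> simp
  · refine Finset.sum_eq_zero fun i _ => ?_
    simp [hy, hne]

/-- A nonzero constraint value of a binary assignment is at least one. -/
theorem IsBinaryAssignment.one_le_pairingConstraint {d : ℕ} {x : Sym2 (Fin d) → ℝ}
    (hx : IsBinaryAssignment d x) (h : pairingConstraint d x ≠ 0) :
    1 ≤ pairingConstraint d x := by
  have hrow : ∀ i : Fin d, ∃ z : ℤ,
      ∑ j ∈ Finset.univ.filter (· ≠ i), x s(i, j) = (z : ℝ) := by
    intro i
    refine ⟨∑ j ∈ Finset.univ.filter (· ≠ i), if x s(i, j) = 1 then 1 else 0, ?_⟩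
    push_cast
    refine Finset.sum_congr rfl fun j hj => ?_
    rcases hx i j (Finset.mem_filter.mp hj).2.symm with h | h <;> simp [h]
  choose z hz using hrow
  have hC : pairingConstraint d x = ((∑ i, (1 - z i) ^ 2 : ℤ) : ℝ) := by
    simp only [pairingConstraint, hz]
    push_cast
    rfl
  rw [hC] at h ⊢
  have h0 : (0 : ℤ) ≤ ∑ i, (1 - z i) ^ 2 := Finset.sum_nonneg fun i _ => sq_nonneg _
  have h1 : (∑ i, (1 - z i) ^ 2 : ℤ) ≠ 0 := by exact_mod_cast h
  exact_mod_cast h0.lt_of_ne' h1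

/-- Let `d` be even, `W` a nonnegative weight on unordered pairs of distinct
elements of `Fin d`, and `P > ∑_{i<j} W {i,j}`.  Then every binary assignment
minimizing the QUBO objective satisfies the pairing constraint
`∑ i, (1 − ∑ j ≠ i, x {i,j})² = 0`. -/
theorem qubo_minimizer_satisfies_constraint
    (d : ℕ) (hd : Even d) (W : Sym2 (Fin d) → ℝ)
    (hW : ∀ i j : Fin d, i ≠ j → 0 ≤ W s(i, j)) (P : ℝ)
    (hP : (∑ i : Fin d, ∑ j ∈ Finset.Ioi i, W s(i, j)) < P)
    (x : Sym2 (Fin d) → ℝ) (hx : IsBinaryAssignment d x)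
    (hmin : ∀ y : Sym2 (Fin d) → ℝ, IsBinaryAssignment d y →
      quboObjective d W P x ≤ quboObjective d W P y) :
    pairingConstraint d x = 0 := by
  by_contra hC
  have hC1 := hx.one_le_pairingConstraint hC
  obtain ⟨y, hy, hy0⟩ := exists_isBinaryAssignment_pairingConstraint_eq_zero hd
  have hle := hmin y hy
  simp only [quboObjective, hy0, mul_zero, add_zero] at hle
  have hP0 : 0 ≤ P := hP.le.trans' <| Finset.sum_nonneg fun i _ =>
    Finset.sum_nonneg fun j hj => hW i j (Finset.mem_Ioi.mp hj).ne
  have hx0 : 0 ≤ ∑ i : Fin d, ∑ j ∈ Finset.Ioi i, W s(i, j) * x s(i, j) := by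
    refine Finset.sum_nonneg fun i _ => Finset.sum_nonneg fun j hj => ?_
    have hij := (Finset.mem_Ioi.mp hj).ne
    rcases hx i j hij with h | h <;> simp [h, hW i j hij]
  have hyW : ∑ i : Fin d, ∑ j ∈ Finset.Ioi i, W s(i, j) * y s(i, j) ≤
      ∑ i : Fin d, ∑ j ∈ Finset.Ioi i, W s(i, j) := by
    refine Finset.sum_le_sum fun i _ => Finset.sum_le_sum fun j hj => ?_
    have hij := (Finset.mem_Ioi.mp hj).ne
    rcases hy i j hij with h | h <;> simp [h, hW i j hij]
  have hPC := le_mul_of_one_le_right hP0 hC1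
  linarith
end

section
/- Let G be a finite connected simple graph on a nonempty vertex set with edge weights w : Sym2 V → ℝ satisfying w(e) ≥ 0 for every edge e, and let O be the set of vertices of G of odd degree. For every perfect pairing A of O there exists a closed walk p in G whose edge list contains every edge of G and whose walk weight is at most Σ_{e ∈ E(G)} w(e) + Σ_{{u,v} ∈ A} dist_w(u,v). -/
/-- The walk weight of a walk: the sum, over the edge list of the walk
(edges counted with multiplicity), of the weights of those edges. -/
def SimpleGraph.Walk.weight {V : Type*} {G : SimpleGraph V} (w : Sym2 V → ℝ)
    {u v : V} (p : G.Walk u v) : ℝ :=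
  (p.edges.map w).sum

/-- The set of vertices of odd degree of a finite simple graph. -/
def SimpleGraph.oddDegreeVertices {V : Type*} [Fintype V] (G : SimpleGraph V)
    [DecidableRel G.Adj] : Finset V :=
  Finset.univ.filter fun v => Odd (G.degree v)

/-- A perfect pairing of a finite set `O`: a collection of unordered pairs of
distinct elements of `O` (2-element subsets of `O`) such that every element of
`O` lies in exactly one pair. -/
def IsPerfectPairingOn {V : Type*} (O : Finset V) (A : Finset (Sym2 V)) : Prop :=
  (∀ e ∈ A, ¬ e.IsDiag ∧ ∀ v ∈ e, v ∈ O) ∧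
    ∀ v ∈ O, ∃! e : Sym2 V, e ∈ A ∧ v ∈ e

/-- The shortest-path distance `dist_w` between the two endpoints of an
unordered pair `{u,v}`: the infimum of the walk weights over all walks in `G`
from `u` to `v`. -/
noncomputable def pairDist {V : Type*} (G : SimpleGraph V) (w : Sym2 V → ℝ)
    (e : Sym2 V) : ℝ :=
  sInf {r : ℝ | ∃ u v : V, e = s(u, v) ∧
    ∃ p : G.Walk u v, r = SimpleGraph.Walk.weight w p}

namespace SimpleGraph.Walk

variable {V : Type*} {G : SimpleGraph V}

theorem even_countP_edges_iff [DecidableEq V] {u v : V} (p : G.Walk u v) (x : V) :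
    Even (p.edges.countP fun e => x ∈ e) ↔ u ≠ v → x ≠ u ∧ x ≠ v := by
  induction p with
  | nil => simp
  | cons huv p ih =>
    simp only [List.countP_cons, Ne, edges_cons, Sym2.mem_iff]
    split_ifs with h
    · rw [decide_eq_true_eq] at h
      have := huv.ne
      rw [Nat.even_add_one, ih]
      grind
    · grind

theorem weight_bypass_le [DecidableEq V] {w : Sym2 V → ℝ} (hw : ∀ e ∈ G.edgeSet, 0 ≤ w e)
    {u v : V} (p : G.Walk u v) : p.bypass.weight w ≤ p.weight w := by
  refine (p.edges_bypass_sublist_edges.map w).sum_le_sum fun a ha => ?_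
  obtain ⟨e, he, rfl⟩ := List.mem_map.1 ha
  exact hw e (p.edges_subset_edgeSet he)

theorem exists_weight_minimal [Finite V] {w : Sym2 V → ℝ} (hw : ∀ e ∈ G.edgeSet, 0 ≤ w e)
    {u v : V} (h : G.Reachable u v) :
    ∃ p : G.Walk u v, ∀ q : G.Walk u v, p.weight w ≤ q.weight w := by
  classical
  have := Fintype.ofFinite V
  obtain ⟨q₀⟩ := h
  have : Nonempty (G.Path u v) := ⟨q₀.toPath⟩
  obtain ⟨p, hp⟩ := Finite.exists_min fun p : G.Path u v => p.1.weight w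
  exact ⟨p.1, fun q => (hp q.toPath).trans (weight_bypass_le hw q)⟩

end SimpleGraph.Walk

namespace SimpleGraph

variable {V : Type*} {G : SimpleGraph V}

theorem exists_walk_weight_le_pairDist [Finite V] (hG : G.Connected) {w : Sym2 V → ℝ}
    (hw : ∀ e ∈ G.edgeSet, 0 ≤ w e) (a b : V) :
    ∃ p : G.Walk a b, p.weight w ≤ pairDist G w s(a, b) := by
  obtain ⟨p, hp⟩ := Walk.exists_weight_minimal hw (hG a b)
  refine ⟨p, le_csInf ⟨_, a, b, rfl, p, rfl⟩ ?_⟩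
  rintro r ⟨u, v, huv, q, rfl⟩
  obtain ⟨rfl, rfl⟩ | ⟨rfl, rfl⟩ := Sym2.eq_iff.1 huv
  · exact hp q
  · simpa [Walk.weight] using hp q.reverse

/-- The edges of a weight-minimal walk joining the endpoints of an unordered pair. -/
theorem exists_edges_weight_le_pairDist [Finite V] [DecidableEq V] (hG : G.Connected)
    {w : Sym2 V → ℝ} (hw : ∀ e ∈ G.edgeSet, 0 ≤ w e) (e : Sym2 V) :
    ∃ M : Multiset (Sym2 V), (∀ x ∈ M, x ∈ G.edgeSet) ∧
      (¬ e.IsDiag → ∀ v, Odd (M.countP fun x => v ∈ x) ↔ v ∈ e) ∧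
      (M.map w).sum ≤ pairDist G w e := by
  induction e with | _ a b
  obtain ⟨p, hp⟩ := exists_walk_weight_le_pairDist hG hw a b
  refine ⟨p.edges, fun x hx => p.edges_subset_edgeSet hx, fun hab v => ?_, by simpa [Walk.weight] using hp⟩
  rw [Sym2.mk_isDiag_iff] at hab
  rw [Multiset.coe_countP, ← Nat.not_even_iff_odd, p.even_countP_edges_iff, Sym2.mem_iff]
  tauto

/-- Euler's theorem for the multigraph with edge multiset `M`. -/
theorem Connected.exists_closed_walk_edges_eq [DecidableEq V]
    (hG : G.Connected) (M : Multiset (Sym2 V)) (hM : ∀ e ∈ M, e ∈ G.edgeSet)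
    (hGM : ∀ e ∈ G.edgeSet, e ∈ M) (heven : ∀ v, Even (M.countP fun e => v ∈ e)) :
    ∃ (u : V) (p : G.Walk u u), (p.edges : Multiset (Sym2 V)) = M := by
  classical
  let P : ℕ → Prop := fun n =>
    ∃ (u v : V) (p : G.Walk u v), p.length = n ∧ (p.edges : Multiset (Sym2 V)) ≤ M
  have hP0 : P 0 := by
    obtain ⟨u⟩ := hG.nonempty
    exact ⟨u, u, .nil, rfl, by simp⟩
  obtain ⟨u, v, p, hlen, hpM⟩ := Nat.findGreatest_spec (Nat.zero_le M.card) hP0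
  have hmax {a b : V} (q : G.Walk a b) (hq : (q.edges : Multiset (Sym2 V)) ≤ M) :
      q.length ≤ p.length := by
    rw [hlen]
    refine Nat.le_findGreatest ?_ ⟨a, b, q, rfl, hq⟩
    simpa using Multiset.card_le_card hq
  have hext {a b c : V} (q : G.Walk b c) (hab : G.Adj a b) (hq : (q.edges : Multiset (Sym2 V)) ≤ M)
      (hlen : q.length = p.length) (he : s(a, b) ∈ M - (q.edges : Multiset (Sym2 V))) : False := by
    have hle : ((q.cons hab).edges : Multiset (Sym2 V)) ≤ M := by
      rw [Walk.edges_cons, ← Multiset.cons_coe, ← Multiset.singleton_add]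
      exact (add_le_add_left (Multiset.singleton_le.2 he) _).trans_eq (tsub_add_cancel_of_le hq)
    have := hmax _ hle
    rw [Walk.length_cons] at this
    omega
  obtain rfl : u = v := by
    by_contra huv
    have hodd : ¬ Even ((p.edges : Multiset (Sym2 V)).countP fun e => u ∈ e) := by
      rw [Multiset.coe_countP, p.even_countP_edges_iff]
      tauto
    obtain ⟨e, he, hue⟩ : ∃ e ∈ M - (p.edges : Multiset (Sym2 V)), u ∈ e := by
      rw [← Multiset.countP_pos, Multiset.countP_sub hpM]
      have := Multiset.countP_le_of_le (fun e => u ∈ e) hpM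
      have hne : (p.edges : Multiset (Sym2 V)).countP (fun e => u ∈ e) ≠
          M.countP fun e => u ∈ e := fun h => hodd (h ▸ heven u)
      omega
    obtain ⟨b, rfl⟩ := Sym2.mem_iff_exists.1 hue
    have hub : G.Adj u b := hM _ (Multiset.mem_of_le tsub_le_self he)
    exact hext p hub.symm hpM rfl (Sym2.eq_swap ▸ he)
  refine ⟨u, p, by_contra fun hne => ?_⟩
  obtain ⟨a, b, hb, he⟩ : ∃ a b, b ∈ p.support ∧ s(a, b) ∈ M - (p.edges : Multiset (Sym2 V)) := by
    by_cases hs : ∀ x, x ∈ p.support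
    · obtain ⟨e, he⟩ := Multiset.exists_mem_of_ne_zero
        (fun h => hne (hpM.antisymm (tsub_eq_zero_iff_le.1 h)))
      induction e with | _ a b
      exact ⟨a, b, hs b, he⟩
    · push Not at hs
      obtain ⟨x, hx⟩ := hs
      obtain ⟨q⟩ := hG u x
      obtain ⟨d, -, hd, hd'⟩ := q.exists_boundary_dart {y | y ∈ p.support} p.start_mem_support hx
      refine ⟨d.snd, d.fst, hd, Multiset.mem_sub.2 ?_⟩
      have hnot : s(d.snd, d.fst) ∉ (p.edges : Multiset (Sym2 V)) := fun h =>
        hd' (p.fst_mem_support_of_mem_edges h)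
      rw [Multiset.count_eq_zero_of_notMem hnot, Multiset.count_pos]
      exact hGM _ d.adj.symm
  have hrot : ((p.rotate b hb).edges : Multiset (Sym2 V)) = p.edges :=
    Multiset.coe_eq_coe.2 (p.rotate_edges b hb).perm
  refine hext (p.rotate b hb) (hM _ (Multiset.mem_of_le tsub_le_self he)) (hrot ▸ hpM) ?_
    (hrot ▸ he)
  simp

theorem countP_mem_edgeFinset [Fintype V] [DecidableEq V] [DecidableRel G.Adj] (v : V) :
    G.edgeFinset.val.countP (fun e => v ∈ e) = G.degree v := by
  rw [Multiset.countP_eq_card_filter, ← card_incidenceFinset_eq_degree,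
    G.incidenceFinset_eq_filter v]
  rfl

end SimpleGraph

theorem IsPerfectPairingOn.odd_card_filter_mem_iff {V : Type*} [DecidableEq V] {O : Finset V}
    {A : Finset (Sym2 V)} (hA : IsPerfectPairingOn O A) (v : V) :
    Odd (A.filter fun e => v ∈ e).card ↔ v ∈ O := by
  constructor
  · intro h
    obtain ⟨e, he⟩ := Finset.card_pos.1 h.pos
    rw [Finset.mem_filter] at he
    exact (hA.1 e he.1).2 v he.2
  · intro h
    obtain ⟨e, he, huniq⟩ := hA.2 v h
    have : A.filter (fun e => v ∈ e) = {e} := by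
      ext x
      rw [Finset.mem_filter, Finset.mem_singleton]
      exact ⟨huniq x, fun hx => hx ▸ he⟩
    simp [this]

/-- Let `G` be a finite connected simple graph on a nonempty vertex set with
nonnegative edge weights `w`, and let `O` be its set of odd-degree vertices.
For every perfect pairing `A` of `O` there exists a closed walk `p` in `G`
whose edge list contains every edge of `G` and whose walk weight is at most
`∑ e ∈ E(G), w e + ∑ {u,v} ∈ A, dist_w u v`. -/
theorem perfect_pairing_gives_postman_tour
    {V : Type*} [Fintype V] [DecidableEq V] [Nonempty V]
    (G : SimpleGraph V) [DecidableRel G.Adj] (hG : G.Connected)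
    (w : Sym2 V → ℝ) (hw : ∀ e ∈ G.edgeSet, 0 ≤ w e)
    (A : Finset (Sym2 V)) (hA : IsPerfectPairingOn G.oddDegreeVertices A) :
    ∃ (u : V) (p : G.Walk u u),
      (∀ e ∈ G.edgeSet, e ∈ p.edges) ∧
        SimpleGraph.Walk.weight w p ≤
          ∑ e ∈ G.edgeFinset, w e + ∑ e ∈ A, pairDist G w e := by
  choose f hfG hfodd hfw using SimpleGraph.exists_edges_weight_le_pairDist hG hw
  obtain ⟨u, p, hp⟩ := hG.exists_closed_walk_edges_eq (G.edgeFinset.val + ∑ e ∈ A, f e)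
    (fun e he => by
      rw [Multiset.mem_add, Multiset.mem_sum] at he
      obtain he | ⟨x, -, he⟩ := he
      · exact SimpleGraph.mem_edgeFinset.1 he
      · exact hfG x e he)
    (fun e he => Multiset.mem_add.2 (.inl (SimpleGraph.mem_edgeFinset.2 he)))
    (fun v => by
      have hsum : (∑ e ∈ A, f e).countP (fun e => v ∈ e) =
          ∑ e ∈ A, (f e).countP fun e => v ∈ e :=
        map_sum (Multiset.countPAddMonoidHom fun e => v ∈ e) f A
      have hfilter : A.filter (fun e => Odd ((f e).countP fun x => v ∈ x)) =
          A.filter fun e => v ∈ e :=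
        Finset.filter_congr fun e he => hfodd e (hA.1 e he).1 v
      rw [Multiset.countP_add, SimpleGraph.countP_mem_edgeFinset, hsum, Nat.even_add',
        Finset.odd_sum_iff_odd_card_odd, hfilter, hA.odd_card_filter_mem_iff,
        SimpleGraph.oddDegreeVertices, Finset.mem_filter]
      simp)
  refine ⟨u, p, fun e he => ?_, ?_⟩
  · rw [← Multiset.mem_coe, hp]
    exact Multiset.mem_add.2 (.inl (SimpleGraph.mem_edgeFinset.2 he))
  · have hweight : p.weight w = ∑ e ∈ G.edgeFinset, w e + ∑ e ∈ A, ((f e).map w).sum := by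
      have h := congrArg (fun M : Multiset (Sym2 V) => (M.map w).sum) hp
      simp only [Multiset.map_coe, Multiset.sum_coe, Multiset.map_add, Multiset.sum_add] at h
      rw [SimpleGraph.Walk.weight, h]
      congr 1
      exact map_sum (Multiset.sumAddMonoidHom.comp (Multiset.mapAddMonoidHom w)) f A
    rw [hweight]
    gcongr with e
    exact hfw e
end

section
/- Let V be a finite type, T ∈ ℕ with T ≥ 1, let E ⊆ V × V be a finite set of directed edges, and let e : Fin T → E → ℝ satisfy e_t(a) ∈ {0,1} for all t, a, together with the one-edge condition: for every t there is exactly one a ∈ E with e_t(a) = 1; write f(t) for this unique edge. Then Σ_{t=0}^{T−2} Σ_{(j,k) ∈ E} Σ_{(r,s) ∈ E, r ≠ k, (r,s) ≠ (j,k)} e_t(j,k) · e_{t+1}(r,s) = 0 if and only if for every t ≤ T−2, either the first coordinate of f(t+1) equals the second coordinate of f(t), or f(t+1) = f(t). Hence the constraint C_adjacency vanishes exactly when each chosen edge either follows the previous chosen edge head-to-tail or repeats it. -/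
/-- Let `V` be a finite type, `T = n + 1 ≥ 1`, `E` a finite set of directed
edges, and `e : Fin T → V × V → ℝ` binary on `E` satisfying the one-edge
condition, with `f t` the unique edge of `E` traversed at step `t`.  Then the
adjacency constraint
`∑_{t ≤ T−2} ∑_{(j,k) ∈ E} ∑_{(r,s) ∈ E, r ≠ k, (r,s) ≠ (j,k)} e_t(j,k) ⬝ e_{t+1}(r,s)`
vanishes if and only if for every `t ≤ T−2`, either the first coordinate of
`f (t+1)` equals the second coordinate of `f t`, or `f (t+1) = f t`:
each chosen edge either follows the previous one head-to-tail or repeats it. -/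
theorem adjacency_constraint_iff
    {V : Type*} [Fintype V] [DecidableEq V]
    (n : ℕ) (E : Finset (V × V))
    (e : Fin (n + 1) → V × V → ℝ) (f : Fin (n + 1) → V × V)
    (hbin : ∀ t, ∀ a ∈ E, e t a = 0 ∨ e t a = 1)
    (hone : ∀ t : Fin (n + 1), ∃! a : V × V, a ∈ E ∧ e t a = 1)
    (hf : ∀ t : Fin (n + 1), f t ∈ E ∧ e t (f t) = 1) :
    (∑ t : Fin n, ∑ jk ∈ E,
        ∑ rs ∈ E.filter (fun rs => rs.1 ≠ jk.2 ∧ rs ≠ jk),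
          e t.castSucc jk * e t.succ rs = 0) ↔
      ∀ t : Fin n,
        (f t.succ).1 = (f t.castSucc).2 ∨ f t.succ = f t.castSucc := by
  have indicator : ∀ t, ∀ a ∈ E, e t a = if a = f t then 1 else 0 := by
    intro t a ha
    split_ifs with h
    · rw [h]; exact (hf t).2
    · exact (hbin t a ha).resolve_right fun h1 => h ((hone t).unique ⟨ha, h1⟩ (hf t))
  have nonneg : ∀ t, ∀ a ∈ E, 0 ≤ e t a := by
    intro t a ha
    rcases hbin t a ha with h | h <;> simp [h]
  have term_nonneg : ∀ t : Fin n, ∀ jk ∈ E,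
      ∀ rs ∈ E.filter (fun rs => rs.1 ≠ jk.2 ∧ rs ≠ jk),
        0 ≤ e t.castSucc jk * e t.succ rs := fun t jk hjk rs hrs =>
    mul_nonneg (nonneg _ _ hjk) (nonneg _ _ (Finset.mem_filter.1 hrs).1)
  rw [Finset.sum_eq_zero_iff_of_nonneg fun t _ =>
    Finset.sum_nonneg fun jk hjk => Finset.sum_nonneg (term_nonneg t jk hjk)]
  refine ⟨fun h t => ?_, fun h t _ => ?_⟩
  · by_contra! hne
    have h1 := (Finset.sum_eq_zero_iff_of_nonneg fun jk hjk =>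
      Finset.sum_nonneg (term_nonneg t jk hjk)).1 (h t (Finset.mem_univ t)) _ (hf t.castSucc).1
    have h2 := (Finset.sum_eq_zero_iff_of_nonneg
      (term_nonneg t _ (hf t.castSucc).1)).1 h1 (f t.succ)
      (Finset.mem_filter.2 ⟨(hf t.succ).1, hne⟩)
    simp [(hf _).2] at h2
  · refine Finset.sum_eq_zero fun jk hjk => Finset.sum_eq_zero fun rs hrs => ?_
    obtain ⟨hrsE, hne1, hne2⟩ := Finset.mem_filter.1 hrs
    rw [indicator _ _ hjk, indicator _ _ hrsE]
    split_ifs with hj hr <;> simp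
    subst hj hr
    exact (h t).elim hne1 hne2
end

section
/- Let V be a finite type, T ∈ ℕ with T ≥ 1, let E ⊆ V × V be a finite set of directed edges, let R ⊆ E be a set of required edges, and let e : Fin T → E → ℝ satisfy e_t(a) ∈ {0,1} for all t, a. Assume: (i) for every t there is exactly one a ∈ E with e_t(a) = 1, written f(t); (ii) for every t ≤ T−2, either the first coordinate of f(t+1) equals the second coordinate of f(t) or f(t+1) = f(t); and (iii) for every r ∈ R there exists t with f(t) = r. Let L be the list obtained from (f(0), …, f(T−1)) by collapsing consecutive equal entries. Then consecutive entries of L satisfy head-to-tail adjacency (the second coordinate of each entry equals the first coordinate of the next), i.e., L is the edge sequence of a walk in the directed graph (V, E), and this walk traverses every required edge of R. Hence any binary assignment with C_one_edge = C_adjacency = C_required = 0 decodes to a valid postman walk covering all required edges. -/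
theorem List.exists_destutter'_eq_cons {α : Type*} (R : α → α → Prop) [DecidableRel R]
    (a : α) (l : List α) : ∃ t, l.destutter' R a = a :: t := by
  induction l with
  | nil => exact ⟨[], rfl⟩
  | cons b l ih =>
    by_cases h : R a b
    · exact ⟨_, List.destutter'_cons_pos l h⟩
    · rwa [List.destutter'_cons_neg l h]

theorem List.IsChain.destutter'_ne {α : Type*} [DecidableEq α] {S : α → α → Prop}
    {a : α} {l : List α} (h : (a :: l).IsChain (fun x y => S x y ∨ y = x)) :
    (l.destutter' (· ≠ ·) a).IsChain S := by
  induction l generalizing a with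
  | nil => simp
  | cons b l ih =>
    rw [List.isChain_cons_cons] at h
    by_cases hab : a ≠ b
    · rw [List.destutter'_cons_pos l hab]
      have hb := ih h.2
      obtain ⟨t, ht⟩ := List.exists_destutter'_eq_cons (· ≠ ·) b l
      rw [ht] at hb ⊢
      exact List.isChain_cons_cons.2 ⟨h.1.resolve_right hab.symm, hb⟩
    · rw [List.destutter'_cons_neg l hab]
      obtain rfl := not_not.1 hab
      exact ih h.2

theorem List.IsChain.destutter_ne {α : Type*} [DecidableEq α] {S : α → α → Prop}
    {l : List α} (h : l.IsChain (fun x y => S x y ∨ y = x)) :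
    (l.destutter (· ≠ ·)).IsChain S := by
  cases l with
  | nil => simp
  | cons a l => exact h.destutter'_ne

theorem List.mem_destutter'_ne_of_mem {α : Type*} [DecidableEq α] {a x : α} {l : List α}
    (h : x ∈ a :: l) : x ∈ l.destutter' (· ≠ ·) a := by
  induction l generalizing a with
  | nil => simpa using h
  | cons b l ih =>
    by_cases hab : a ≠ b
    · rw [List.destutter'_cons_pos l hab]
      rcases List.mem_cons.1 h with rfl | h
      · exact List.mem_cons_self
      · exact List.mem_cons_of_mem _ (ih h)
    · rw [List.destutter'_cons_neg l hab]
      obtain rfl := not_not.1 hab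
      exact ih (by simpa using h)

theorem List.mem_destutter_ne_of_mem {α : Type*} [DecidableEq α] {x : α} {l : List α}
    (h : x ∈ l) : x ∈ l.destutter (· ≠ ·) := by
  cases l with
  | nil => simp at h
  | cons a l => exact List.mem_destutter'_ne_of_mem h


/-- Decoding a valid QUBO assignment into a postman walk.  Let `V` be a finite
type, `T = n + 1 ≥ 1`, `E` a finite set of directed edges, `R ⊆ E` the required
edges, and `e : Fin T → V × V → ℝ` binary on `E`.  Assume (i) at each step
exactly one edge of `E` is traversed, written `f t`; (ii) consecutive chosen
edges are head-to-tail adjacent or equal; (iii) every required edge is chosen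
at some step.  Let `L` be the list `(f 0, …, f (T−1))` with consecutive equal
entries collapsed.  Then the entries of `L` lie in `E`, consecutive entries of
`L` are head-to-tail adjacent (so `L` is the edge sequence of a walk in the
directed graph `(V, E)`), and this walk traverses every required edge of `R`. -/
theorem decode_valid_assignment_to_walk
    {V : Type*} [Fintype V] [DecidableEq V]
    (n : ℕ) (E R : Finset (V × V)) (hRE : R ⊆ E)
    (e : Fin (n + 1) → V × V → ℝ) (f : Fin (n + 1) → V × V)
    (hbin : ∀ t, ∀ a ∈ E, e t a = 0 ∨ e t a = 1)
    (hone : ∀ t : Fin (n + 1), ∃! a : V × V, a ∈ E ∧ e t a = 1)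
    (hf : ∀ t : Fin (n + 1), f t ∈ E ∧ e t (f t) = 1)
    (hadj : ∀ t : Fin n,
      (f t.succ).1 = (f t.castSucc).2 ∨ f t.succ = f t.castSucc)
    (hreq : ∀ r ∈ R, ∃ t : Fin (n + 1), f t = r) :
    (∀ a ∈ (List.ofFn f).destutter (· ≠ ·), a ∈ E) ∧
      ((List.ofFn f).destutter (· ≠ ·)).Chain' (fun a b => a.2 = b.1) ∧
      ∀ r ∈ R, r ∈ (List.ofFn f).destutter (· ≠ ·) := by
  refine ⟨fun a ha => ?_, List.IsChain.destutter_ne ?_, fun r hr => ?_⟩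
  · obtain ⟨t, rfl⟩ := List.mem_ofFn.1 ((List.destutter_sublist _ _).subset ha)
    exact (hf t).1
  · rw [List.isChain_iff_getElem]
    intro i hi
    rw [List.length_ofFn] at hi
    rw [List.getElem_ofFn, List.getElem_ofFn]
    exact (hadj ⟨i, by omega⟩).imp_left Eq.symm
  · exact List.mem_destutter_ne_of_mem (List.mem_ofFn.2 (hreq r hr))
end
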